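/- Let h = (h(n))_{n≥1} be a sequence of integers with h(n) ≡ g(n) (mod 2) for all n ≥ 1, where g is the ruler function g(n) = ν₂(2n), and let H(z) = Σ_{n≥1} h(n) z^n ∈ ℤ[[z]]. Then for every k ≥ 1 there exist polynomials P_k(z), Q_k(z) ∈ ℤ[z], each of degree at most k, with Q_k(0) ≠ 0, such that the formal power series Q_k(z)·H(z) − P_k(z) has coefficient 0 in every degree ≤ 2k and a nonzero coefficient in degree 2k+1 (i.e., H(z) − P_k(z)/Q_k(z) = h_k z^{2k+1} + O(z^{2k+2}) for some nonzero rational h_k). -/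

import Mathlib

/-- The ruler function `g(n) = ν₂(2n)`. -/
def ruler (n : ℕ) : ℤ := (padicValNat 2 (2 * n) : ℤ)

open PowerSeries in
/-- Let `F 0, F 1, …` be the successive tails of a continued fraction
`F i = X / (1 + a i X + X F (i + 1))`. Every nonzero solution of the linear Padé problem of order `k`
for `F i` has a denominator that does not vanish at `0`, and an error of exact order `2 * k + 1`. -/
theorem pade_nondegenerate_of_continuedFraction {K : Type*} [Field K] (F : ℕ → PowerSeries K)
    (a : ℕ → K) (hF : ∀ i, F i * (1 + C (a i) * X + X * F (i + 1)) = X) (k : ℕ) :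
    ∀ (i : ℕ) (P Q : Polynomial K), P.natDegree ≤ k → Q.natDegree ≤ k → Q ≠ 0 →
      (X : PowerSeries K) ^ (2 * k + 1) ∣ (Q : PowerSeries K) * F i - (P : PowerSeries K) →
      Q.coeff 0 ≠ 0 ∧
        coeff (2 * k + 1) ((Q : PowerSeries K) * F i - (P : PowerSeries K)) ≠ 0 := by
  have hF0 (i : ℕ) : (X : PowerSeries K) ∣ F i := by
    rw [X_dvd_iff]
    simpa using congrArg (constantCoeff (R := K)) (hF i)
  have hX : (X : PowerSeries K) ≠ 0 := X_ne_zero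
  induction k with
  | zero =>
    intro i P Q hP hQ hQ0 _
    obtain ⟨q, rfl⟩ := Polynomial.natDegree_eq_zero.mp (Nat.le_zero.mp hQ)
    obtain ⟨p, rfl⟩ := Polynomial.natDegree_eq_zero.mp (Nat.le_zero.mp hP)
    have hq : q ≠ 0 := by simpa using hQ0
    obtain ⟨E, hE⟩ := hF0 i
    have hED : E * (1 + C (a i) * X + X * F (i + 1)) = 1 := by
      apply mul_left_cancel₀ hX
      rw [← mul_assoc, ← hE, hF, mul_one]
    have hE0 : constantCoeff (R := K) E = 1 := by
      simpa using congrArg (constantCoeff (R := K)) hED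
    have hF1 : coeff 1 (F i) = 1 := by
      rw [hE, ← zero_add 1, coeff_succ_X_mul, coeff_zero_eq_constantCoeff_apply, hE0]
    refine ⟨by simpa using hq, ?_⟩
    simpa [Polynomial.coe_C, coeff_C, hF1] using hq
  | succ k ih =>
    intro i P Q hP hQ hQ0 ⟨S, hS⟩
    set D : PowerSeries K := 1 + C (a i) * X + X * F (i + 1) with hD
    have hD0 : constantCoeff (R := K) D = 1 := by simp [hD]
    have hcF : constantCoeff (R := K) (F i) = 0 := X_dvd_iff.mp (hF0 i)
    have hP0 : P.coeff 0 = 0 := by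
      simpa [hcF] using congrArg (constantCoeff (R := K)) hS
    obtain ⟨P', rfl⟩ := Polynomial.X_dvd_iff.mpr hP0
    have hTP : (Q : PowerSeries K) - (P' : PowerSeries K) * D = X ^ (2 * k + 2) * (S * D) := by
      apply mul_left_cancel₀ hX
      rw [Polynomial.coe_mul, Polynomial.coe_X] at hS
      linear_combination D * hS - (Q : PowerSeries K) * hF i
    have hT0 : (Q - (1 + Polynomial.C (a i) * Polynomial.X) * P').coeff 0 = 0 := by
      have := congrArg (constantCoeff (R := K)) hTP
      simp [hD0] at this
      simpa [Polynomial.mul_coeff_zero] using this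
    obtain ⟨Q', hQ'⟩ := Polynomial.X_dvd_iff.mpr hT0
    have hQ'coe : (Q : PowerSeries K) - (1 + C (a i) * X) * (P' : PowerSeries K) =
        X * (Q' : PowerSeries K) := by
      simpa using congrArg (Polynomial.toPowerSeries) hQ'
    have hrel : (P' : PowerSeries K) * F (i + 1) - (Q' : PowerSeries K) =
        X ^ (2 * k + 1) * (-(S * D)) := by
      apply mul_left_cancel₀ hX
      rw [hD] at hTP ⊢
      linear_combination hQ'coe - hTP
    have hdP' : P'.natDegree ≤ k := by
      by_cases h : P' = 0
      · simp [h]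
      · rw [Polynomial.natDegree_X_mul h] at hP
        omega
    have hdQ' : Q'.natDegree ≤ k := by
      by_cases h : Q' = 0
      · simp [h]
      · have h1 : (Polynomial.X * Q').natDegree ≤ k + 1 := by
          rw [← hQ']
          refine (Polynomial.natDegree_sub_le _ _).trans (max_le hQ ?_)
          refine Polynomial.natDegree_mul_le.trans ?_
          have : (1 + Polynomial.C (a i) * Polynomial.X : Polynomial K).natDegree ≤ 1 := by
            compute_degree
          omega
        rw [Polynomial.natDegree_X_mul h] at h1
        omega
    have hP'0 : P' ≠ 0 := by
      rintro rfl
      have hQ'0 : Q' = 0 := by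
        ext n
        by_cases hn : n < 2 * k + 1
        · have := X_pow_dvd_iff.mp ⟨_, hrel⟩ n hn
          simpa using this
        · exact Polynomial.coeff_eq_zero_of_natDegree_lt (by omega)
      apply hQ0
      simpa [hQ'0] using hQ'
    obtain ⟨h1, h2⟩ := ih (i + 1) Q' P' hdQ' hdP' hP'0 ⟨_, hrel⟩
    have hS0 : constantCoeff (R := K) S ≠ 0 := by
      rw [hrel, coeff_X_pow_mul'] at h2
      simpa [hD0] using h2
    refine ⟨?_, ?_⟩
    · have : Q.coeff 0 - P'.coeff 0 = 0 := by simpa [Polynomial.mul_coeff_zero] using hT0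
      rwa [sub_eq_zero.mp this]
    · rw [hS, coeff_X_pow_mul']
      simpa using hS0

/-- The linear Padé problem over `ℤ` always has a solution with primitive denominator. -/
theorem exists_isPrimitive_pade (H : PowerSeries ℤ) (k : ℕ) :
    ∃ P Q : Polynomial ℤ, P.natDegree ≤ k ∧ Q.natDegree ≤ k ∧ Q.IsPrimitive ∧
      ∀ j ≤ 2 * k, PowerSeries.coeff j ((Q : PowerSeries ℤ) * H - (P : PowerSeries ℤ)) = 0 := by
  obtain ⟨Q, hQd, hQ0, hQ⟩ : ∃ Q : Polynomial ℤ, Q.natDegree ≤ k ∧ Q ≠ 0 ∧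
      ∀ i : Fin k, PowerSeries.coeff (k + 1 + i) ((Q : PowerSeries ℤ) * H) = 0 := by
    let L : (Fin (k + 1) → ℤ) →ₗ[ℤ] (Fin k → ℤ) :=
      LinearMap.pi (fun i => PowerSeries.coeff (k + 1 + i)) ∘ₗ
        LinearMap.mulRight ℤ H ∘ₗ
        (Polynomial.coeToPowerSeries.algHom (R := ℤ) ℤ).toLinearMap ∘ₗ
        (Polynomial.degreeLT ℤ (k + 1)).subtype ∘ₗ
        (Polynomial.degreeLTEquiv ℤ (k + 1)).symm.toLinearMap
    have hL : ¬ Function.Injective L := fun h => by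
      simpa using LinearMap.finrank_le_finrank_of_injective h
    rw [← LinearMap.ker_eq_bot, Submodule.eq_bot_iff] at hL
    push Not at hL
    obtain ⟨v, hv, hv0⟩ := hL
    set q := (Polynomial.degreeLTEquiv ℤ (k + 1)).symm v with hq
    refine ⟨q, ?_, ?_, ?_⟩
    · have := Polynomial.mem_degreeLT.mp q.2
      exact Polynomial.natDegree_le_iff_coeff_eq_zero.mpr fun n hn =>
        (Polynomial.degree_lt_iff_coeff_zero _ _).mp this n hn
    · simpa [hq] using hv0
    · intro i
      have := congrFun hv i
      simpa [L, Polynomial.coeToPowerSeries.algHom_apply] using this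
  have hc : Q.content ≠ 0 := by rwa [Ne, Polynomial.content_eq_zero_iff]
  refine ⟨((Q.primPart : PowerSeries ℤ) * H).trunc (k + 1), Q.primPart,
    Nat.lt_succ_iff.mp (PowerSeries.natDegree_trunc_lt _ _),
    Q.natDegree_primPart.trans_le hQd, Q.isPrimitive_primPart, fun j hj => ?_⟩
  rw [map_sub, Polynomial.coeff_coe, PowerSeries.coeff_trunc]
  split_ifs with hjk
  · simp
  · rw [sub_zero]
    have := hQ ⟨j - (k + 1), by omega⟩
    rw [Q.eq_C_content_mul_primPart, Polynomial.coe_mul, Polynomial.coe_C, mul_assoc,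
      PowerSeries.coeff_C_mul, Fin.val_mk, Nat.add_sub_cancel' (by omega)] at this
    exact (mul_eq_zero.mp this).resolve_left hc

theorem ruler_two_mul_add_one (m : ℕ) : ruler (2 * m + 1) = 1 := by
  rw [ruler, padicValNat.mul two_ne_zero (by omega), padicValNat_self,
    padicValNat.eq_zero_of_not_dvd (by omega)]
  rfl

theorem ruler_two_mul {m : ℕ} (hm : m ≠ 0) : ruler (2 * m) = 1 + ruler m := by
  rw [ruler, ruler, padicValNat.mul two_ne_zero (by omega), padicValNat_self]
  push_cast
  rfl

theorem PowerSeries.two_eq_zero_zmod_two : (2 : PowerSeries (ZMod 2)) = 0 := by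
  simpa only [map_ofNat, map_zero] using
    congrArg (C (R := ZMod 2)) (CharTwo.two_eq_zero (R := ZMod 2))

theorem PowerSeries.coeff_sq_zmod_two (f : PowerSeries (ZMod 2)) (n : ℕ) :
    coeff n (f ^ 2) = if 2 ∣ n then coeff (n / 2) f else 0 := by
  have h := MvPowerSeries.map_frobenius_expand 2 two_ne_zero (f := f)
  rw [ZMod.frobenius_zmod, MvPowerSeries.map_id] at h
  rw [← coeff_expand 2 two_ne_zero]
  exact congrArg (coeff n) h.symm

/-- Modulo 2, the shifted generating function `U` of the ruler function is a root of
`(1 + X) (X U ^ 2 + U) = 1`. -/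
theorem one_add_X_mul_ruler_series (U : PowerSeries (ZMod 2))
    (hU : ∀ n, PowerSeries.coeff n U = (ruler (n + 1) : ZMod 2)) :
    (1 + PowerSeries.X) * (PowerSeries.X * U ^ 2 + U) = 1 := by
  have hV : PowerSeries.X * U ^ 2 + U = PowerSeries.mk 1 := by
    ext n
    rw [map_add, PowerSeries.coeff_mk, hU, Pi.one_apply]
    rcases n with _ | n
    · simp [ruler_two_mul_add_one 0]
    · rw [PowerSeries.coeff_succ_X_mul, PowerSeries.coeff_sq_zmod_two]
      rcases Nat.even_or_odd' n with ⟨m, rfl | rfl⟩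
      · rw [if_pos (dvd_mul_right 2 m), Nat.mul_div_cancel_left _ two_pos, hU,
          show 2 * m + 1 + 1 = 2 * (m + 1) by ring, ruler_two_mul (by omega), Int.cast_add,
          add_left_comm, CharTwo.add_self_eq_zero]
        simp
      · rw [if_neg (by omega), show 2 * m + 1 + 1 + 1 = 2 * (m + 1) + 1 by ring,
          ruler_two_mul_add_one]
        simp
  rw [hV]
  linear_combination PowerSeries.mk_one_mul_one_sub_eq_one (ZMod 2) +
    PowerSeries.X * PowerSeries.mk 1 * PowerSeries.two_eq_zero_zmod_two

theorem pade_approximant_of_modEq_ruler (h : ℕ → ℤ)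
    (hh : ∀ n, 1 ≤ n → h n ≡ ruler n [ZMOD 2]) :
    ∀ k : ℕ, 1 ≤ k →
      ∃ P Q : Polynomial ℤ,
        P.natDegree ≤ k ∧ Q.natDegree ≤ k ∧ Q.coeff 0 ≠ 0 ∧
        (∀ j ≤ 2 * k,
          (PowerSeries.coeff (R := ℤ) j)
            ((Q : PowerSeries ℤ) * PowerSeries.mk (fun n => if n = 0 then 0 else h n)
              - (P : PowerSeries ℤ)) = 0) ∧
        (PowerSeries.coeff (R := ℤ) (2 * k + 1))
            ((Q : PowerSeries ℤ) * PowerSeries.mk (fun n => if n = 0 then 0 else h n)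
              - (P : PowerSeries ℤ)) ≠ 0 := by
  intro k _
  set H : PowerSeries ℤ := PowerSeries.mk (fun n => if n = 0 then 0 else h n) with hH
  obtain ⟨P, Q, hP, hQ, hprim, hPQ⟩ := exists_isPrimitive_pade H k
  let φ : ℤ →+* ZMod 2 := Int.castRingHom (ZMod 2)
  let U : PowerSeries (ZMod 2) := PowerSeries.mk fun n => (ruler (n + 1) : ZMod 2)
  have hU := one_add_X_mul_ruler_series U fun n => PowerSeries.coeff_mk _ _
  have hHU : H.map φ = PowerSeries.X * U := by
    ext n
    rcases n with _ | n
    · simp [hH]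
    · rw [PowerSeries.coeff_succ_X_mul]
      simpa [hH, φ, U] using (ZMod.intCast_eq_intCast_iff _ _ 2).mpr (hh (n + 1) (by omega))
  let F : ℕ → PowerSeries (ZMod 2)
    | 0 => PowerSeries.X * U
    | _ + 1 => (1 + PowerSeries.X) * U + 1
  let a : ℕ → ZMod 2
    | 0 => 0
    | _ + 1 => 1
  have hF (i : ℕ) :
      F i * (1 + PowerSeries.C (a i) * PowerSeries.X + PowerSeries.X * F (i + 1))
        = PowerSeries.X := by
    rcases i with _ | i
    · simp only [F, a, map_zero]
      linear_combination PowerSeries.X * hU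
    · simp only [F, a, map_one]
      linear_combination (1 + PowerSeries.X) * hU +
        (1 + PowerSeries.X * ((1 + PowerSeries.X) * U + 1)) * PowerSeries.two_eq_zero_zmod_two
  have hmap : ((Q : PowerSeries ℤ) * H - (P : PowerSeries ℤ)).map φ
      = ((Q.map φ : Polynomial (ZMod 2)) : PowerSeries (ZMod 2)) * F 0
        - ((P.map φ : Polynomial (ZMod 2)) : PowerSeries (ZMod 2)) := by
    rw [map_sub, map_mul, hHU, Polynomial.polynomial_map_coe, Polynomial.polynomial_map_coe]
  have hQ0 : Q.map φ ≠ 0 := by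
    intro h0
    have hdvd : Polynomial.C 2 ∣ Q := by
      rw [Polynomial.C_dvd_iff_dvd_coeff]
      intro i
      have := congrArg (fun p => Polynomial.coeff p i) h0
      exact (ZMod.intCast_zmod_eq_zero_iff_dvd (Q.coeff i) 2).mp (by simpa [φ] using this)
    have := hprim 2 hdvd
    revert this
    decide
  obtain ⟨h0, h1⟩ := pade_nondegenerate_of_continuedFraction F a hF k 0 (P.map φ) (Q.map φ)
    (Polynomial.natDegree_map_le.trans hP) (Polynomial.natDegree_map_le.trans hQ) hQ0 (by
      rw [← hmap, PowerSeries.X_pow_dvd_iff]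
      intro j hj
      rw [PowerSeries.coeff_map, hPQ j (by omega), map_zero])
  refine ⟨P, Q, hP, hQ, fun h => h0 (by simp [h]), hPQ, fun h => h1 ?_⟩
  rw [← hmap, PowerSeries.coeff_map, h, map_zero]
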